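/- arXiv:math/0408116 — 4 statements merged into one kernel-verified Lean document; each statement's English description precedes it below -/
import Mathlib

section
/- The spectrum of the discrete Laplacian operator Δ on ℓ²(ℤ) is exactly the interval [-4, 0]; that is, a complex number λ belongs to the spectrum of Δ if and only if λ is real and -4 ≤ λ ≤ 0. -/
/-- Translation is isometric on `ℓ²(ℤ)`. -/
theorem lp_two_exists_translate (x : lp (fun _ : ℤ => ℂ) 2) (a : ℤ) :
    ∃ y : lp (fun _ : ℤ => ℂ) 2, (∀ k, y k = x (k + a)) ∧ ‖y‖ = ‖x‖ := by
  have h2 : 0 < (2 : ENNReal).toReal := by norm_num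
  have hx := (Equiv.addRight a).summable_iff.mpr ((memℓp_gen_iff h2).mp (lp.memℓp x))
  refine ⟨⟨fun k => x (k + a), (memℓp_gen_iff h2).mpr hx⟩, fun k => rfl, ?_⟩
  rw [lp.norm_eq_tsum_rpow h2, lp.norm_eq_tsum_rpow h2]
  exact congrArg (· ^ _) ((Equiv.addRight a).tsum_eq fun k => ‖x k‖ ^ (2 : ENNReal).toReal)

section DiscreteLaplacian

variable {Δ : lp (fun _ : ℤ => ℂ) 2 →L[ℂ] lp (fun _ : ℤ => ℂ) 2}

theorem discrete_laplacian_single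
    (hΔ : ∀ (x : lp (fun _ : ℤ => ℂ) 2) (k : ℤ), Δ x k = x (k - 1) + x (k + 1) - 2 * x k)
    (k : ℤ) (c : ℂ) :
    Δ (lp.single 2 k c) =
      lp.single 2 (k + 1) c + lp.single 2 (k - 1) c - (2 : ℂ) • lp.single 2 k c := by
  ext j
  rw [hΔ]
  simp only [lp.coeFn_sub, lp.coeFn_add, lp.coeFn_smul, Pi.sub_apply, Pi.add_apply, Pi.smul_apply,
    lp.coeFn_single, Pi.single_apply, smul_eq_mul, sub_eq_iff_eq_add, eq_sub_iff_add_eq]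

theorem isSelfAdjoint_discrete_laplacian
    (hΔ : ∀ (x : lp (fun _ : ℤ => ℂ) 2) (k : ℤ), Δ x k = x (k - 1) + x (k + 1) - 2 * x k) :
    IsSelfAdjoint Δ := by
  rw [ContinuousLinearMap.isSelfAdjoint_iff']
  ext x k
  have h (y : lp (fun _ : ℤ => ℂ) 2) (j : ℤ) : y j = inner ℂ (lp.single 2 j (1 : ℂ)) y := by
    simp [lp.inner_single_left]
  rw [h, ContinuousLinearMap.adjoint_inner_right, discrete_laplacian_single hΔ, hΔ]
  simp only [inner_sub_left, inner_add_left, inner_smul_left, ← h]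
  simp only [map_ofNat]
  ring

theorem norm_discrete_laplacian_add_two_le
    (hΔ : ∀ (x : lp (fun _ : ℤ => ℂ) 2) (k : ℤ), Δ x k = x (k - 1) + x (k + 1) - 2 * x k) :
    ‖Δ + algebraMap ℂ _ 2‖ ≤ 2 := by
  refine ContinuousLinearMap.opNorm_le_bound _ zero_le_two fun x => ?_
  obtain ⟨y, hy, hyx⟩ := lp_two_exists_translate x (-1)
  obtain ⟨z, hz, hzx⟩ := lp_two_exists_translate x 1
  have h : (Δ + algebraMap ℂ _ 2) x = y + z := by
    ext k
    change Δ x k + (2 : ℂ) * x k = y k + z k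
    rw [hΔ, hy, hz, ← sub_eq_add_neg, sub_add_cancel]
  rw [h]
  linarith [norm_add_le y z]

/-- On a truncated plane wave, `Δ - (w + w⁻¹ - 2)` leaves only boundary terms. -/
theorem discrete_laplacian_truncated_wave
    (hΔ : ∀ (x : lp (fun _ : ℤ => ℂ) 2) (k : ℤ), Δ x k = x (k - 1) + x (k + 1) - 2 * x k)
    {w : ℂ} (hw : w ≠ 0) (n : ℕ) :
    Δ (∑ i ∈ Finset.range n, lp.single 2 (i : ℤ) (w ^ (i : ℤ))) -
        (w + w⁻¹ - 2) • ∑ i ∈ Finset.range n, lp.single 2 (i : ℤ) (w ^ (i : ℤ)) =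
      lp.single 2 (-1) 1 - lp.single 2 0 w⁻¹ + lp.single 2 (n : ℤ) (w ^ ((n : ℤ) - 1)) -
        lp.single 2 ((n : ℤ) - 1) (w ^ (n : ℤ)) := by
  have single_eq (k : ℤ) (c : ℂ) :
      (lp.single 2 k c : lp (fun _ : ℤ => ℂ) 2) = c • lp.single 2 k 1 := by
    rw [← lp.single_smul, smul_eq_mul, mul_one]
  induction n with
  | zero => simp
  | succ n ih =>
    rw [Finset.sum_range_succ, map_add, smul_add, add_sub_add_comm, ih,
      discrete_laplacian_single hΔ]
    push_cast
    rw [add_sub_cancel_right]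
    rw [zpow_sub_one₀ hw, zpow_add_one₀ hw]
    simp only [single_eq _ w⁻¹, single_eq _ (w ^ (n : ℤ)), single_eq _ (w ^ (n : ℤ) * w),
      single_eq _ (w ^ (n : ℤ) * w⁻¹)]
    module

theorem mem_spectrum_discrete_laplacian
    (hΔ : ∀ (x : lp (fun _ : ℤ => ℂ) 2) (k : ℤ), Δ x k = x (k - 1) + x (k + 1) - 2 * x k)
    {w : ℂ} (hw : ‖w‖ = 1) : w + w⁻¹ - 2 ∈ spectrum ℂ Δ := by
  have hw0 : w ≠ 0 := by
    rintro rfl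
    simp at hw
  intro hu
  obtain ⟨u, hu⟩ := hu
  set R : lp (fun _ : ℤ => ℂ) 2 →L[ℂ] lp (fun _ : ℤ => ℂ) 2 := ↑u⁻¹ with hR
  have bound (n : ℕ) : (n : ℝ) ≤ (‖R‖ * 4) ^ 2 := by
    set x : lp (fun _ : ℤ => ℂ) 2 :=
      ∑ i ∈ Finset.range n, lp.single 2 (i : ℤ) (w ^ (i : ℤ)) with hx
    have hnorm : ‖x‖ ^ 2 = n := by
      have h := lp.norm_sum_single (E := fun _ : ℤ => ℂ) (p := 2) (by norm_num)
        (fun i => w ^ i) ((Finset.range n).map Nat.castEmbedding)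
      simp only [Finset.sum_map, Nat.castEmbedding_apply] at h
      rw [← hx] at h
      simpa [hw] using h
    have hux : ‖(u : lp (fun _ : ℤ => ℂ) 2 →L[ℂ] lp (fun _ : ℤ => ℂ) 2) x‖ ≤ 4 := by
      rw [hu, sub_apply, Algebra.algebraMap_eq_smul_one,
        smul_apply, one_apply_eq_self, norm_sub_rev,
        discrete_laplacian_truncated_wave hΔ hw0]
      refine (norm_sub_le _ _).trans ?_
      refine (add_le_add_left ((norm_add_le _ _).trans
        (add_le_add_left (norm_sub_le _ _) _)) _).trans ?_
      simp only [lp.norm_single zero_lt_two, norm_zpow, norm_inv, hw, norm_one, one_zpow, inv_one]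
      norm_num
    have hRx : x = R ((u : lp (fun _ : ℤ => ℂ) 2 →L[ℂ] lp (fun _ : ℤ => ℂ) 2) x) := by
      rw [← mul_apply_eq_comp, hR, Units.inv_mul, one_apply_eq_self]
    rw [← hnorm]
    gcongr
    calc ‖x‖ = _ := congrArg norm hRx
      _ ≤ ‖R‖ * _ := R.le_opNorm _
      _ ≤ ‖R‖ * 4 := by gcongr
  obtain ⟨n, hn⟩ := exists_nat_gt ((‖R‖ * 4) ^ 2)
  exact (bound n).not_gt hn

end DiscreteLaplacian

/-- The spectrum of the discrete Laplacian operator `Δ` on `ℓ²(ℤ)`, i.e. the bounded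
operator defined by `(Δ x) k = x (k-1) + x (k+1) - 2 * x k`, is exactly the real
interval `[-4, 0]` viewed inside `ℂ`. -/
theorem spectrum_discrete_laplacian
    (Δ : lp (fun _ : ℤ => ℂ) 2 →L[ℂ] lp (fun _ : ℤ => ℂ) 2)
    (hΔ : ∀ (x : lp (fun _ : ℤ => ℂ) 2) (k : ℤ),
      Δ x k = x (k - 1) + x (k + 1) - 2 * x k) :
    spectrum ℂ Δ = {z : ℂ | ∃ t : ℝ, z = (t : ℂ) ∧ -4 ≤ t ∧ t ≤ 0} := by
  ext z
  constructor
  · intro hz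
    have hre := (isSelfAdjoint_discrete_laplacian hΔ).mem_spectrum_eq_re hz
    have hz2 : z + 2 ∈ spectrum ℂ (Δ + algebraMap ℂ _ 2) := by
      rw [← spectrum.add_singleton_eq]
      exact Set.add_mem_add hz rfl
    have hle : ‖z + 2‖ ≤ 2 :=
      (spectrum.norm_le_norm_mul_of_mem hz2).trans <|
        (mul_le_of_le_one_right (norm_nonneg _) ContinuousLinearMap.norm_id_le).trans
          (norm_discrete_laplacian_add_two_le hΔ)
    have habs := abs_le.mp ((Complex.abs_re_le_norm _).trans hle)
    simp only [Complex.add_re, Complex.re_ofNat] at habs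
    exact ⟨z.re, hre, by linarith, by linarith⟩
  · rintro ⟨t, rfl, ht, ht'⟩
    have hcos : Real.cos (Real.arccos ((t + 2) / 2)) = (t + 2) / 2 :=
      Real.cos_arccos (by linarith) (by linarith)
    convert mem_spectrum_discrete_laplacian hΔ
      (Complex.norm_exp_ofReal_mul_I (Real.arccos ((t + 2) / 2))) using 1
    rw [← Complex.exp_neg, ← neg_mul, ← Complex.two_cos, ← Complex.ofReal_cos, hcos]
    push_cast
    ring
end

section
/- For all η, r ∈ ℝ, the operator norm of ℋ on ℓ²(ℤ) satisfies ‖ℋ‖ ≤ 4. -/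
theorem lp.hasSum_norm_sq {ι : Type*} {E : ι → Type*} [∀ i, NormedAddCommGroup (E i)]
    (f : lp E 2) : HasSum (fun i => ‖f i‖ ^ 2) (‖f‖ ^ 2) := by
  simpa using lp.hasSum_norm (p := 2) (by simp) f

theorem Real.cosh_sq_le_cosh_sub_mul_cosh_add (a b : ℝ) :
    Real.cosh a ^ 2 ≤ Real.cosh (a - b) * Real.cosh (a + b) := by
  have h : Real.cosh (a - b) * Real.cosh (a + b) = Real.cosh a ^ 2 + Real.sinh b ^ 2 := by
    rw [Real.cosh_sub, Real.cosh_add]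
    linear_combination Real.cosh a ^ 2 * Real.cosh_sq b - Real.sinh b ^ 2 * Real.sinh_sq a
  rw [h]
  linarith [sq_nonneg (Real.sinh b)]

/-- Schur-type bound: an operator on `ℓ²(ℤ)` dominated pointwise by the tridiagonal kernel
`(1, 2, 1)` has norm at most `4`. -/
theorem norm_le_four_of_norm_apply_le {E : Type*} [NormedAddCommGroup E] [NormedSpace ℂ E]
    (T : lp (fun _ : ℤ => E) 2 →L[ℂ] lp (fun _ : ℤ => E) 2)
    (hT : ∀ ν x, ‖T ν x‖ ≤ ‖ν (x - 1)‖ + ‖ν (x + 1)‖ + 2 * ‖ν x‖) : ‖T‖ ≤ 4 := by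
  refine T.opNorm_le_bound (by norm_num) fun ν => ?_
  have h : HasSum (fun x : ℤ => ‖ν x‖ ^ 2) (‖ν‖ ^ 2) := lp.hasSum_norm_sq ν
  have hsub : HasSum (fun x : ℤ => ‖ν (x - 1)‖ ^ 2) (‖ν‖ ^ 2) :=
    (Equiv.subRight (1 : ℤ)).hasSum_iff (f := fun x : ℤ => ‖ν x‖ ^ 2) |>.mpr h
  have hadd : HasSum (fun x : ℤ => ‖ν (x + 1)‖ ^ 2) (‖ν‖ ^ 2) :=
    (Equiv.addRight (1 : ℤ)).hasSum_iff (f := fun x : ℤ => ‖ν x‖ ^ 2) |>.mpr h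
  have hpt : ∀ x, ‖T ν x‖ ^ 2 ≤
      4 * (‖ν (x - 1)‖ ^ 2 + ‖ν (x + 1)‖ ^ 2 + 2 * ‖ν x‖ ^ 2) := fun x => by
    refine (pow_le_pow_left₀ (norm_nonneg _) (hT ν x) 2).trans ?_
    nlinarith [sq_nonneg (‖ν (x - 1)‖ - ‖ν (x + 1)‖), sq_nonneg (‖ν (x - 1)‖ - ‖ν x‖),
      sq_nonneg (‖ν (x + 1)‖ - ‖ν x‖)]
  have hle := hasSum_le hpt (lp.hasSum_norm_sq (T ν))
    (((hsub.add hadd).add (h.mul_left 2)).mul_left 4)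
  refine (abs_le_of_sq_le_sq' ?_ (by positivity)).2
  linarith

/-- For all `η, r : ℝ`, the operator `ℋ` on `ℓ²(ℤ)` defined by
`(ℋ ν) x = -(1 / cosh η) * (ν (x-1) + ν (x+1)) + ε x * ν x`, with
`ε x = 2 cosh(η(x-r))² / (cosh(η(x-1-r)) cosh(η(x+1-r)))`, has operator norm at most `4`. -/
theorem opH_norm_le_four (η r : ℝ)
    (ℋ : lp (fun _ : ℤ => ℂ) 2 →L[ℂ] lp (fun _ : ℤ => ℂ) 2)
    (hℋ : ∀ (ν : lp (fun _ : ℤ => ℂ) 2) (x : ℤ),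
      ℋ ν x = -(1 / Real.cosh η : ℝ) * (ν (x - 1) + ν (x + 1)) +
        ((2 * Real.cosh (η * (x - r)) ^ 2 /
          (Real.cosh (η * (x - 1 - r)) * Real.cosh (η * (x + 1 - r)))) : ℝ) * ν x) :
    ‖ℋ‖ ≤ 4 := by
  refine norm_le_four_of_norm_apply_le ℋ fun ν x => ?_
  have hhop : |1 / Real.cosh η| ≤ 1 := by
    rw [abs_of_pos (by positivity), div_le_one (Real.cosh_pos η)]
    exact Real.one_le_cosh η
  have hdiag : |2 * Real.cosh (η * (x - r)) ^ 2 /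
      (Real.cosh (η * (x - 1 - r)) * Real.cosh (η * (x + 1 - r)))| ≤ 2 := by
    have h := Real.cosh_sq_le_cosh_sub_mul_cosh_add (η * (x - r)) η
    rw [show η * (x - r) - η = η * (x - 1 - r) by ring,
      show η * (x - r) + η = η * (x + 1 - r) by ring] at h
    rw [abs_of_nonneg (by positivity), div_le_iff₀ (by positivity)]
    linarith
  rw [hℋ]
  refine (norm_add_le _ _).trans (add_le_add ?_ ?_)
  · rw [norm_mul, norm_neg, Complex.norm_real, Real.norm_eq_abs]
    exact (mul_le_of_le_one_left (norm_nonneg _) hhop).trans (norm_add_le _ _)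
  · rw [norm_mul, Complex.norm_real, Real.norm_eq_abs]
    exact mul_le_mul_of_nonneg_right hdiag (norm_nonneg _)
end

section
/- Fix η > 0 and r ∈ ℝ. The multiplication operator T on ℓ²(ℤ) defined by (Tν)_x = (ε_x - 2)·ν_x is a compact operator. -/
open Filter Topology in
/-- A diagonal operator on `ℓᵖ` whose symbol tends to zero along the cofinite filter is compact. -/
theorem isCompactOperator_of_diagonal {ι : Type*} {p : ENNReal} [Fact (1 ≤ p)] {a : ι → ℂ}
    (ha : Tendsto a cofinite (𝓝 0))
    (T : lp (fun _ : ι => ℂ) p →L[ℂ] lp (fun _ : ι => ℂ) p)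
    (hT : ∀ (ν : lp (fun _ : ι => ℂ) p) (x : ι), T ν x = a x * ν x) :
    IsCompactOperator T := by
  classical
  have hp : p ≠ 0 := (lt_of_lt_of_le one_pos (Fact.out : 1 ≤ p)).ne'
  let S : Finset ι → lp (fun _ : ι => ℂ) p →L[ℂ] lp (fun _ : ι => ℂ) p := fun s =>
    ∑ i ∈ s, (lp.singleContinuousLinearMap ℂ (fun _ : ι => ℂ) p i).comp
      (a i • lp.evalCLM ℂ (fun _ : ι => ℂ) p i)
  have hS : ∀ s ν x, S s ν x = if x ∈ s then a x * ν x else 0 := by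
    intro s ν x
    have h : ∀ f : lp (fun _ : ι => ℂ) p, ∀ i, lp.evalCLM ℂ (fun _ : ι => ℂ) p i f = f i :=
      fun _ _ => rfl
    rw [← h, sum_apply, map_sum]
    simp [h, Pi.single_apply]
  have hSc : ∀ s, IsCompactOperator (S s) := by
    intro s
    refine Submodule.sum_mem (compactOperator (RingHom.id ℂ) _ _) fun i _ => ?_
    exact (isCompactOperator_of_locallyCompactSpace_rng
      (lp.singleContinuousLinearMap ℂ (fun _ : ι => ℂ) p i)).comp_clm
        (a i • lp.evalCLM ℂ (fun _ : ι => ℂ) p i)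
  refine isCompactOperator_of_tendsto (l := atTop) (F := S) ?_ (Eventually.of_forall hSc)
  rw [Metric.tendsto_nhds]
  intro ε hε
  have hfin : {x | ¬ ‖a x‖ < ε / 2}.Finite := by
    simpa using (Metric.tendsto_nhds.1 ha) (ε / 2) (half_pos hε)
  filter_upwards [eventually_ge_atTop hfin.toFinset] with s hs
  rw [dist_eq_norm]
  refine lt_of_le_of_lt (ContinuousLinearMap.opNorm_le_bound _ (half_pos hε).le fun ν => ?_)
    (half_lt_self hε)
  have hnorm : ‖(((ε / 2 : ℝ) : ℂ) • ν : lp (fun _ : ι => ℂ) p)‖ = ε / 2 * ‖ν‖ := by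
    rw [lp.norm_const_smul hp, Complex.norm_real, Real.norm_of_nonneg (half_pos hε).le]
  rw [← hnorm]
  refine lp.norm_mono hp fun x => ?_
  have hx : (S s - T) ν x = S s ν x - T ν x := rfl
  rw [hx, hS, hT, lp.coeFn_smul, Pi.smul_apply, norm_smul, Complex.norm_real,
    Real.norm_of_nonneg (half_pos hε).le]
  split_ifs with h
  · simpa using mul_nonneg (half_pos hε).le (norm_nonneg (ν x))
  · have : ‖a x‖ < ε / 2 := by
      by_contra hc
      exact h (hs (hfin.mem_toFinset.2 hc))
    rw [zero_sub, norm_neg, norm_mul]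
    gcongr

theorem Real.cosh_sub_mul_cosh_add (u v : ℝ) :
    Real.cosh (u - v) * Real.cosh (u + v) = Real.cosh u ^ 2 + Real.sinh v ^ 2 := by
  rw [Real.cosh_sub, Real.cosh_add]
  linear_combination Real.cosh u ^ 2 * Real.cosh_sq v - Real.sinh v ^ 2 * Real.sinh_sq u

theorem Real.abs_le_cosh_sq (u : ℝ) : |u| ≤ Real.cosh u ^ 2 := by
  have h : |u| ≤ Real.sinh |u| := Real.self_le_sinh_iff.2 (abs_nonneg u)
  rw [← Real.cosh_abs, Real.cosh_sq]
  nlinarith [sq_nonneg (Real.sinh |u| - 1)]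

open Filter Topology in
theorem tendsto_eps_sub_two (η r : ℝ) (hη : 0 < η) :
    Tendsto (fun x : ℤ => 2 * Real.cosh (η * (x - r)) ^ 2 /
      (Real.cosh (η * (x - 1 - r)) * Real.cosh (η * (x + 1 - r))) - 2) cofinite (𝓝 0) := by
  have key : ∀ x : ℤ, 2 * Real.cosh (η * (x - r)) ^ 2 /
      (Real.cosh (η * (x - 1 - r)) * Real.cosh (η * (x + 1 - r))) - 2 =
      -(2 * Real.sinh η ^ 2) / (Real.cosh (η * (x - r)) ^ 2 + Real.sinh η ^ 2) := by
    intro x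
    rw [show η * ((x : ℝ) - 1 - r) = η * (x - r) - η by ring,
      show η * ((x : ℝ) + 1 - r) = η * (x - r) + η by ring, Real.cosh_sub_mul_cosh_add]
    have : Real.cosh (η * (x - r)) ^ 2 + Real.sinh η ^ 2 ≠ 0 := by
      have := Real.cosh_pos (η * (x - r))
      positivity
    field_simp
    ring
  simp only [key]
  refine Tendsto.const_div_atTop ?_ _
  have habs : Tendsto (fun x : ℤ => η * (|(x : ℝ)| - |r|)) cofinite atTop :=
    (tendsto_atTop_add_const_right _ (-|r|)
      (tendsto_norm_cocompact_atTop.comp Int.tendsto_coe_cofinite)).const_mul_atTop hη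
  refine tendsto_atTop_mono (fun x => ?_) habs
  calc η * (|(x : ℝ)| - |r|) ≤ η * |(x : ℝ) - r| := by
        gcongr
        exact abs_sub_abs_le_abs_sub _ _
    _ = |η * (x - r)| := by rw [abs_mul, abs_of_pos hη]
    _ ≤ Real.cosh (η * (x - r)) ^ 2 := Real.abs_le_cosh_sq _
    _ ≤ _ := le_add_of_nonneg_right (sq_nonneg _)


/-- Fix `η > 0` and `r : ℝ`. The multiplication operator `T` on `ℓ²(ℤ)` defined by
`(T ν) x = (ε x - 2) * ν x` is a compact operator. -/
theorem mul_eps_sub_two_compact (η r : ℝ) (hη : 0 < η)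
    (T : lp (fun _ : ℤ => ℂ) 2 →L[ℂ] lp (fun _ : ℤ => ℂ) 2)
    (hT : ∀ (ν : lp (fun _ : ℤ => ℂ) 2) (x : ℤ),
      T ν x = ((2 * Real.cosh (η * (x - r)) ^ 2 /
          (Real.cosh (η * (x - 1 - r)) * Real.cosh (η * (x + 1 - r))) - 2) : ℝ) * ν x) :
    IsCompactOperator T := by
  refine isCompactOperator_of_diagonal ?_ T hT
  exact (Complex.continuous_ofReal.tendsto' 0 0 Complex.ofReal_zero).comp
    (tendsto_eps_sub_two η r hη)
end

section
/- For all η, r ∈ ℝ, the operator ℋ on ℓ²(ℤ) is self-adjoint, and its spectrum is contained in the real interval [0, 4]: every λ in the spectrum of ℋ is real with 0 ≤ λ ≤ 4. -/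
open scoped ComplexConjugate

lemma Summable.hasSum_sub_int_succ {E : Type*} [AddCommGroup E] [TopologicalSpace E]
    [IsTopologicalAddGroup E] {g : ℤ → E} (hg : Summable g) :
    HasSum (fun x => g x - g (x + 1)) 0 := by
  obtain ⟨a, ha⟩ := hg
  have h := (Equiv.addRight (1 : ℤ)).hasSum_iff.mpr ha
  simpa [Function.comp_def] using! ha.sub h

lemma HasSum.nonneg_of_telescoping_le {t g : ℤ → ℝ} {a : ℝ} (ht : HasSum t a) (hg : Summable g)
    (h : ∀ x, g x - g (x + 1) ≤ t x) : 0 ≤ a :=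
  hasSum_le h hg.hasSum_sub_int_succ ht

lemma Complex.two_mul_re_mul_conj_le (a b : ℂ) {s : ℝ} (hs : 0 < s) :
    2 * (a * conj b).re ≤ s * ‖a‖ ^ 2 + s⁻¹ * ‖b‖ ^ 2 := by
  rw [Complex.sq_norm, Complex.sq_norm, Complex.normSq_apply, Complex.normSq_apply,
    Complex.mul_re, Complex.conj_re, Complex.conj_im, ← sub_nonneg]
  have key : s * (a.re * a.re + a.im * a.im) + s⁻¹ * (b.re * b.re + b.im * b.im) -
      2 * (a.re * b.re - a.im * -b.im) =
      s⁻¹ * ((s * a.re - b.re) ^ 2 + (s * a.im - b.im) ^ 2) := by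
    field_simp
    ring
  rw [key]
  positivity

lemma lp.summable_norm_sq {ι : Type*} (f : lp (fun _ : ι => ℂ) 2) :
    Summable fun i => ‖f i‖ ^ 2 := by
  simpa using (lp.memℓp f).summable (by norm_num)

lemma Summable.comp_sub_one {E : Type*} [AddCommMonoid E] [TopologicalSpace E]
    {g : ℤ → E} (hg : Summable g) : Summable fun x => g (x - 1) :=
  (Equiv.subRight (1 : ℤ)).summable_iff.mpr hg

lemma Summable.mul_conj_comp_sub_one {f g : ℤ → ℂ} (hf : Summable fun x => ‖f x‖ ^ 2)
    (hg : Summable fun x => ‖g x‖ ^ 2) : Summable fun x => f x * conj (g (x - 1)) := by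
  refine Summable.of_norm_bounded (hf.add hg.comp_sub_one) fun x => ?_
  rw [norm_mul, RCLike.norm_conj]
  nlinarith [sq_nonneg (‖f x‖ - ‖g (x - 1)‖), sq_nonneg ‖f x‖, sq_nonneg ‖g (x - 1)‖]

/-- The spectrum of a self-adjoint operator lies between bounds of its quadratic form. -/
lemma IsSelfAdjoint.exists_real_mem_Icc_of_mem_spectrum {E : Type*} [NormedAddCommGroup E]
    [InnerProductSpace ℂ E] [CompleteSpace E] {T : E →L[ℂ] E} (hT : IsSelfAdjoint T) {a b : ℝ}
    (ha : ∀ v, a * ‖v‖ ^ 2 ≤ (inner ℂ (T v) v).re) (hb : ∀ v, (inner ℂ (T v) v).re ≤ b * ‖v‖ ^ 2)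
    {z : ℂ} (hz : z ∈ spectrum ℂ T) : ∃ t : ℝ, z = (t : ℂ) ∧ a ≤ t ∧ t ≤ b := by
  have hre := hT.mem_spectrum_eq_re hz
  have hinner (c : ℝ) (v : E) :
      (inner ℂ (algebraMap ℝ (E →L[ℂ] E) c v) v).re = c * ‖v‖ ^ 2 := by
    have : algebraMap ℝ (E →L[ℂ] E) c v = (c : ℂ) • v := by
      simp [Algebra.algebraMap_eq_smul_one]
    rw [this, inner_smul_left, Complex.conj_ofReal, Complex.re_ofReal_mul]
    congr 1
    exact inner_self_eq_norm_sq (𝕜 := ℂ) v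
  have hsa (c : ℝ) : IsSelfAdjoint (algebraMap ℝ (E →L[ℂ] E) c) :=
    IsSelfAdjoint.algebraMap _ (.all c)
  have hlow : algebraMap ℝ (E →L[ℂ] E) a ≤ T := by
    rw [ContinuousLinearMap.le_def, ContinuousLinearMap.isPositive_def']
    refine ⟨hT.sub (hsa a), fun v => ?_⟩
    have := ha v
    simp only [ContinuousLinearMap.reApplyInnerSelf, _root_.sub_apply, inner_sub_left,
      RCLike.re_eq_complex_re, Complex.sub_re, hinner]
    linarith
  have hup : T ≤ algebraMap ℝ (E →L[ℂ] E) b := by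
    rw [ContinuousLinearMap.le_def, ContinuousLinearMap.isPositive_def']
    refine ⟨(hsa b).sub hT, fun v => ?_⟩
    have := hb v
    simp only [ContinuousLinearMap.reApplyInnerSelf, _root_.sub_apply, inner_sub_left,
      RCLike.re_eq_complex_re, Complex.sub_re, hinner]
    linarith
  have hmem : z.re ∈ spectrum ℝ T := by
    rw [hre] at hz
    exact spectrum.of_algebraMap_mem ℂ hz
  exact ⟨z.re, hre, (algebraMap_le_iff_le_spectrum hT).mp hlow _ hmem,
    (le_algebraMap_iff_spectrum_le hT).mp hup _ hmem⟩

/-- A Jacobi operator on `ℓ²(ℤ)` with constant real hopping amplitude is self-adjoint. -/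
lemma isSelfAdjoint_of_jacobi {T : lp (fun _ : ℤ => ℂ) 2 →L[ℂ] lp (fun _ : ℤ => ℂ) 2}
    {k : ℝ} {e : ℤ → ℝ}
    (hT : ∀ ν x, T ν x = -(k : ℂ) * (ν (x - 1) + ν (x + 1)) + (e x : ℂ) * ν x) :
    IsSelfAdjoint T := by
  rw [ContinuousLinearMap.isSelfAdjoint_iff_isSymmetric]
  intro μ ν
  have hg : Summable fun x : ℤ =>
      -(k : ℂ) * (ν x * conj (μ (x - 1)) - conj (μ x * conj (ν (x - 1)))) :=
    (((lp.summable_norm_sq ν).mul_conj_comp_sub_one (lp.summable_norm_sq μ)).sub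
      ((lp.summable_norm_sq μ).mul_conj_comp_sub_one
        (lp.summable_norm_sq ν)).star).mul_left _
  have h := (lp.hasSum_inner (𝕜 := ℂ) (T μ) ν).sub (lp.hasSum_inner (𝕜 := ℂ) μ (T ν))
  refine sub_eq_zero.mp (h.unique ?_)
  convert! hg.hasSum_sub_int_succ using 2 with x
  simp only [hT, RCLike.inner_apply, map_add, map_mul, map_neg, Complex.conj_ofReal,
    Complex.conj_conj, add_sub_cancel_right]
  ring

lemma re_inner_jacobi (a b c : ℂ) (k e : ℝ) :
    (inner ℂ (-(k : ℂ) * (a + b) + (e : ℂ) * c) c).re =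
      e * ‖c‖ ^ 2 - k * ((c * conj a).re + (b * conj c).re) := by
  rw [Complex.sq_norm, Complex.normSq_apply]
  simp [RCLike.inner_apply]
  ring

/-- If `w` is bounded together with its inverse, the potential `e x = k (w x + (w (x - 1))⁻¹)`
makes the Jacobi operator with hopping amplitude `-k` positive. -/
lemma re_inner_jacobi_nonneg {T : lp (fun _ : ℤ => ℂ) 2 →L[ℂ] lp (fun _ : ℤ => ℂ) 2}
    {k : ℝ} {e : ℤ → ℝ}
    (hT : ∀ ν x, T ν x = -(k : ℂ) * (ν (x - 1) + ν (x + 1)) + (e x : ℂ) * ν x)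
    (hk : 0 ≤ k) {w : ℤ → ℝ} (hw : ∀ x, 0 < w x) (he : ∀ x, e x = k * (w x + (w (x - 1))⁻¹))
    {M : ℝ} (hM : ∀ x, w x ≤ M) (hM' : ∀ x, (w x)⁻¹ ≤ M) (ν : lp (fun _ : ℤ => ℂ) 2) :
    0 ≤ (inner ℂ (T ν) ν).re := by
  have hν := lp.summable_norm_sq ν
  have hp : Summable fun x => w x * ‖ν x‖ ^ 2 :=
    .of_nonneg_of_le (fun x => mul_nonneg (hw x).le (sq_nonneg _))
      (fun x => mul_le_mul_of_nonneg_right (hM x) (sq_nonneg _)) (hν.mul_left M)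
  have hq : Summable fun x => (w (x - 1))⁻¹ * ‖ν x‖ ^ 2 :=
    .of_nonneg_of_le (fun x => mul_nonneg (inv_pos.mpr (hw _)).le (sq_nonneg _))
      (fun x => mul_le_mul_of_nonneg_right (hM' _) (sq_nonneg _)) (hν.mul_left M)
  refine (Complex.hasSum_re (lp.hasSum_inner (𝕜 := ℂ) (T ν) ν)).nonneg_of_telescoping_le
    ((hq.sub hp.comp_sub_one).mul_left (k / 2)) fun x => ?_
  rw [hT, re_inner_jacobi, he]
  have h₁ := Complex.two_mul_re_mul_conj_le (ν x) (ν (x - 1)) (inv_pos.mpr (hw (x - 1)))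
  have h₂ := Complex.two_mul_re_mul_conj_le (ν (x + 1)) (ν x) (inv_pos.mpr (hw x))
  rw [inv_inv] at h₁ h₂
  simp only [add_sub_cancel_right]
  linarith [mul_le_mul_of_nonneg_left (add_le_add h₁ h₂) hk]

lemma re_inner_jacobi_le {T : lp (fun _ : ℤ => ℂ) 2 →L[ℂ] lp (fun _ : ℤ => ℂ) 2}
    {k : ℝ} {e : ℤ → ℝ}
    (hT : ∀ ν x, T ν x = -(k : ℂ) * (ν (x - 1) + ν (x + 1)) + (e x : ℂ) * ν x)
    (hk : 0 ≤ k) {M : ℝ} (hM : ∀ x, e x ≤ M) (ν : lp (fun _ : ℤ => ℂ) 2) :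
    (inner ℂ (T ν) ν).re ≤ (M + 2 * k) * ‖ν‖ ^ 2 := by
  have hν := lp.summable_norm_sq ν
  have hnorm : HasSum (fun x => ‖ν x‖ ^ 2) (‖ν‖ ^ 2) := by
    simpa using lp.hasSum_norm (p := 2) (by norm_num) ν
  have h := (hnorm.mul_left (M + 2 * k)).sub
    (Complex.hasSum_re (lp.hasSum_inner (𝕜 := ℂ) (T ν) ν))
  refine sub_nonneg.mp (h.nonneg_of_telescoping_le
    ((hν.sub hν.comp_sub_one).mul_left (k / 2)) fun x => ?_)
  rw [hT, re_inner_jacobi]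
  have h₁ := Complex.two_mul_re_mul_conj_le (-ν x) (ν (x - 1)) one_pos
  have h₂ := Complex.two_mul_re_mul_conj_le (-ν (x + 1)) (ν x) one_pos
  simp only [neg_mul, Complex.neg_re, norm_neg, inv_one, one_mul] at h₁ h₂
  simp only [add_sub_cancel_right]
  linarith [mul_le_mul_of_nonneg_left (add_le_add h₁ h₂) hk,
    mul_le_mul_of_nonneg_right (hM x) (sq_nonneg ‖ν x‖)]

/-- For all `η, r : ℝ`, the operator `ℋ` on `ℓ²(ℤ)` is self-adjoint and its
spectrum is contained in the real interval `[0, 4]`. -/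
theorem opH_selfAdjoint_spectrum_subset (η r : ℝ)
    (ℋ : lp (fun _ : ℤ => ℂ) 2 →L[ℂ] lp (fun _ : ℤ => ℂ) 2)
    (hℋ : ∀ (ν : lp (fun _ : ℤ => ℂ) 2) (x : ℤ),
      ℋ ν x = -(1 / Real.cosh η : ℝ) * (ν (x - 1) + ν (x + 1)) +
        ((2 * Real.cosh (η * (x - r)) ^ 2 /
          (Real.cosh (η * (x - 1 - r)) * Real.cosh (η * (x + 1 - r)))) : ℝ) * ν x) :
    IsSelfAdjoint ℋ ∧
      ∀ z ∈ spectrum ℂ ℋ, ∃ t : ℝ, z = (t : ℂ) ∧ 0 ≤ t ∧ t ≤ 4 := by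
  have hC : 1 ≤ Real.cosh η := Real.one_le_cosh η
  have hk : 0 ≤ 1 / Real.cosh η := by positivity
  have hk' : 1 / Real.cosh η ≤ 1 := (div_le_one (by positivity)).mpr hC
  set c : ℤ → ℝ := fun x => Real.cosh (η * (x - r)) with hc
  have hcpos (x : ℤ) : 0 < c x := Real.cosh_pos _
  have hpred (x : ℤ) : c (x - 1) =
      Real.cosh (η * (x - r)) * Real.cosh η - Real.sinh (η * (x - r)) * Real.sinh η := by
    rw [← Real.cosh_sub]
    simp only [hc]
    push_cast
    ring_nf
  have hsucc (x : ℤ) : c (x + 1) =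
      Real.cosh (η * (x - r)) * Real.cosh η + Real.sinh (η * (x - r)) * Real.sinh η := by
    rw [← Real.cosh_add]
    simp only [hc]
    push_cast
    ring_nf
  have hadd (x : ℤ) : c (x - 1) + c (x + 1) = 2 * Real.cosh η * c x := by
    rw [hpred, hsucc]
    ring
  have hmul (x : ℤ) : c x ^ 2 ≤ c (x - 1) * c (x + 1) := by
    have h : c (x - 1) * c (x + 1) = c x ^ 2 + Real.sinh η ^ 2 := by
      rw [hpred, hsucc]
      linear_combination (Real.cosh (η * (x - r)) ^ 2) * Real.cosh_sq η -
        Real.sinh η ^ 2 * Real.sinh_sq (η * (x - r))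
    nlinarith [sq_nonneg (Real.sinh η)]
  have hT : ∀ ν x, ℋ ν x = -((1 / Real.cosh η : ℝ) : ℂ) * (ν (x - 1) + ν (x + 1)) +
      ((2 * c x ^ 2 / (c (x - 1) * c (x + 1)) : ℝ) : ℂ) * ν x := by
    intro ν x
    rw [hℋ]
    simp [hc]
  have hsa : IsSelfAdjoint ℋ := isSelfAdjoint_of_jacobi hT
  refine ⟨hsa, fun z hz => hsa.exists_real_mem_Icc_of_mem_spectrum (fun ν => ?_) (fun ν => ?_) hz⟩
  · rw [zero_mul]
    refine re_inner_jacobi_nonneg hT hk (w := fun x => c x / c (x + 1))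
      (fun x => div_pos (hcpos _) (hcpos _)) (fun x => ?_) (M := 2 * Real.cosh η)
      (fun x => ?_) (fun x => ?_) ν
    · have h₁ := (hcpos (x - 1)).ne'
      have h₂ := (hcpos (x + 1)).ne'
      simp only [sub_add_cancel]
      field_simp
      linear_combination -c x * hadd x
    · have h := hadd (x + 1)
      rw [add_sub_cancel_right] at h
      rw [div_le_iff₀ (hcpos _)]
      linarith [hcpos (x + 1 + 1)]
    · rw [inv_div, div_le_iff₀ (hcpos _)]
      linarith [hadd x, hcpos (x - 1)]
  · refine (re_inner_jacobi_le hT hk (M := 2) (fun x => ?_) ν).trans ?_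
    · rw [div_le_iff₀ (mul_pos (hcpos _) (hcpos _))]
      linarith [hmul x]
    · gcongr
      linarith
end
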